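/- Let n ≥ 1, let A and B be nonnegative n×n real matrices, and let (x*, y*) be a Nash equilibrium of the SRUC game (A, B) such that both x* and y* have full support. Let δ ∈ [0, 1) and let x̂, ŷ ∈ Δ_n satisfy |x̂_i − x*_i| ≤ δ·x*_i and |ŷ_i − y*_i| ≤ δ·y*_i for all i ∈ {1,…,n}. Then, with ε := 4δ/(1−δ)², the pair (x̂, ŷ) is an ε-approximate Nash equilibrium of the SRUC game (A, B): for every x ∈ Δ_n, e^A(x, ŷ) ≤ (1+ε)·e^A(x̂, ŷ), and for every y ∈ Δ_n, e^B(x̂, y) ≥ e^B(x̂, ŷ)/(1+ε). -/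

import Mathlib

open Finset

/-- Inner product `xᵀy`. -/
noncomputable def dotp {n : ℕ} (x y : Fin n → ℝ) : ℝ := ∑ i, x i * y i

/-- Bilinear form `xᵀCy`. -/
noncomputable def quadForm {n : ℕ} (C : Matrix (Fin n) (Fin n) ℝ) (x y : Fin n → ℝ) : ℝ :=
  ∑ i, ∑ j, x i * C i j * y j

/-- The SRUC payoff `e^C(x,y) ∈ [0,∞]`. -/
noncomputable def payoff {n : ℕ} (C : Matrix (Fin n) (Fin n) ℝ) (x y : Fin n → ℝ) : ENNReal :=
  if 0 < dotp x y then ENNReal.ofReal (quadForm C x y / dotp x y)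
  else if 0 < quadForm C x y then ⊤ else 0

/-- The standard simplex `Δ_n`. -/
def simplex (n : ℕ) : Set (Fin n → ℝ) := {x | (∀ i, 0 ≤ x i) ∧ ∑ i, x i = 1}

/-- Nash equilibrium of the SRUC game `(A, B)`. -/
def IsNash {n : ℕ} (A B : Matrix (Fin n) (Fin n) ℝ) (xs ys : Fin n → ℝ) : Prop :=
  xs ∈ simplex n ∧ ys ∈ simplex n ∧
  (∀ x ∈ simplex n, payoff A x ys ≤ payoff A xs ys) ∧
  (∀ y ∈ simplex n, payoff B xs ys ≤ payoff B xs y)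

/-- `C` is irreducible: `graph(C)` (edges `(i,j)` with `i ≠ j`, `C i j > 0`) is
strongly connected. -/
def MatIrreducible {n : ℕ} (C : Matrix (Fin n) (Fin n) ℝ) : Prop :=
  ∀ i j : Fin n, Relation.ReflTransGen (fun a b => a ≠ b ∧ 0 < C a b) i j

open Matrix in
theorem quadForm_eq_sum_mulVec {n : ℕ} (C : Matrix (Fin n) (Fin n) ℝ) (x y : Fin n → ℝ) :
    quadForm C x y = ∑ i, x i * (C *ᵥ y) i := by
  simp [quadForm, Matrix.mulVec, dotProduct, Finset.mul_sum, mul_assoc]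

theorem payoff_transpose {n : ℕ} (C : Matrix (Fin n) (Fin n) ℝ) (x y : Fin n → ℝ) :
    payoff C.transpose y x = payoff C x y := by
  have hd : dotp y x = dotp x y := by simp [dotp, mul_comm]
  have hq : quadForm C.transpose y x = quadForm C x y := by
    unfold quadForm
    rw [Finset.sum_comm]
    refine Finset.sum_congr rfl fun i _ => Finset.sum_congr rfl fun j _ => ?_
    rw [Matrix.transpose_apply]
    ring
  simp [payoff, hd, hq]

theorem single_mem_simplex {n : ℕ} (i : Fin n) : (Pi.single i 1 : Fin n → ℝ) ∈ simplex n := by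
  refine ⟨fun j => ?_, by simp⟩
  by_cases h : j = i
  · subst h; simp
  · simp [h]

theorem dotp_pos {n : ℕ} {x y : Fin n → ℝ} (hx : x ∈ simplex n) (hy : ∀ i, 0 < y i) :
    0 < dotp x y := by
  have h0 : ∀ i ∈ Finset.univ, 0 ≤ x i * y i := fun i _ => mul_nonneg (hx.1 i) (hy i).le
  refine lt_of_le_of_ne (Finset.sum_nonneg h0) fun h => ?_
  have hz := (Finset.sum_eq_zero_iff_of_nonneg h0).1 h.symm
  have hx0 : ∀ i ∈ Finset.univ, x i = 0 := fun i hi =>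
    (mul_eq_zero.1 (hz i hi)).resolve_right (hy i).ne'
  have h1 := hx.2
  rw [Finset.sum_eq_zero hx0] at h1
  exact zero_ne_one h1

theorem payoff_eq_ofReal {n : ℕ} (C : Matrix (Fin n) (Fin n) ℝ) {x y : Fin n → ℝ}
    (hx : x ∈ simplex n) (hy : ∀ i, 0 < y i) :
    payoff C x y = ENNReal.ofReal (quadForm C x y / dotp x y) :=
  if_pos (dotp_pos hx hy)

open Matrix in
theorem mulVec_nonneg {n : ℕ} {C : Matrix (Fin n) (Fin n) ℝ} (hC : ∀ i j, 0 ≤ C i j)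
    {y : Fin n → ℝ} (hy : ∀ i, 0 < y i) (i : Fin n) : 0 ≤ (C *ᵥ y) i := by
  rw [Matrix.mulVec, dotProduct]
  exact Finset.sum_nonneg fun j _ => mul_nonneg (hC i j) (hy j).le

theorem quadForm_div_dotp_nonneg {n : ℕ} {C : Matrix (Fin n) (Fin n) ℝ} (hC : ∀ i j, 0 ≤ C i j)
    {x y : Fin n → ℝ} (hx : x ∈ simplex n) (hy : ∀ i, 0 < y i) :
    0 ≤ quadForm C x y / dotp x y := by
  refine div_nonneg ?_ (dotp_pos hx hy).le
  rw [quadForm_eq_sum_mulVec]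
  exact Finset.sum_nonneg fun i _ => mul_nonneg (hx.1 i) (mulVec_nonneg hC hy i)

open Matrix in
theorem payoff_single {n : ℕ} (C : Matrix (Fin n) (Fin n) ℝ) {y : Fin n → ℝ}
    (hy : ∀ i, 0 < y i) (i : Fin n) :
    payoff C (Pi.single i 1) y = ENNReal.ofReal ((C *ᵥ y) i / y i) := by
  rw [payoff_eq_ofReal C (single_mem_simplex i) hy, quadForm_eq_sum_mulVec]
  simp [dotp, Pi.single_apply]

/-- Coordinatewise ordered vectors with equal positively weighted sums coincide. -/
theorem eq_of_le_of_sum_mul_eq {n : ℕ} {x u v : Fin n → ℝ} (hx : ∀ i, 0 < x i)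
    (huv : ∀ i, u i ≤ v i) (h : ∑ i, x i * u i = ∑ i, x i * v i) (i : Fin n) : u i = v i :=
  mul_left_cancel₀ (hx i).ne' <| (Finset.sum_eq_sum_iff_of_le fun i _ =>
    mul_le_mul_of_nonneg_left (huv i) (hx i).le).1 h i (Finset.mem_univ i)

theorem quadForm_eq_sum_mul_quotient {n : ℕ} (C : Matrix (Fin n) (Fin n) ℝ) {x y : Fin n → ℝ}
    (hx : x ∈ simplex n) (hy : ∀ i, 0 < y i) :
    quadForm C x y = ∑ i, x i * (quadForm C x y / dotp x y * y i) := by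
  have h : ∑ i, x i * (quadForm C x y / dotp x y * y i)
      = quadForm C x y / dotp x y * dotp x y := by
    rw [dotp, Finset.mul_sum]
    exact Finset.sum_congr rfl fun i _ => by ring
  rw [h, div_mul_cancel₀ _ (dotp_pos hx hy).ne']

open Matrix in
/-- A fully supported maximizer against `y` makes `y` an eigenvector. -/
theorem mulVec_eq_of_payoff_max {n : ℕ} {C : Matrix (Fin n) (Fin n) ℝ} (hC : ∀ i j, 0 ≤ C i j)
    {x y : Fin n → ℝ} (hx : x ∈ simplex n) (hxpos : ∀ i, 0 < x i) (hy : ∀ i, 0 < y i)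
    (hmax : ∀ z ∈ simplex n, payoff C z y ≤ payoff C x y) (i : Fin n) :
    (C *ᵥ y) i = quadForm C x y / dotp x y * y i := by
  refine eq_of_le_of_sum_mul_eq hxpos (u := C *ᵥ y)
    (v := fun i => quadForm C x y / dotp x y * y i) (fun i => ?_) ?_ i
  · have h := hmax _ (single_mem_simplex i)
    rw [payoff_single C hy, payoff_eq_ofReal C hx hy,
      ENNReal.ofReal_le_ofReal_iff (quadForm_div_dotp_nonneg hC hx hy)] at h
    exact (div_le_iff₀ (hy i)).1 h
  · rw [← quadForm_eq_sum_mulVec]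
    exact quadForm_eq_sum_mul_quotient C hx hy

open Matrix in
/-- A fully supported minimizer against `y` makes `y` an eigenvector. -/
theorem mulVec_eq_of_payoff_min {n : ℕ} {C : Matrix (Fin n) (Fin n) ℝ} (hC : ∀ i j, 0 ≤ C i j)
    {x y : Fin n → ℝ} (hx : x ∈ simplex n) (hxpos : ∀ i, 0 < x i) (hy : ∀ i, 0 < y i)
    (hmin : ∀ z ∈ simplex n, payoff C x y ≤ payoff C z y) (i : Fin n) :
    (C *ᵥ y) i = quadForm C x y / dotp x y * y i := by
  refine (eq_of_le_of_sum_mul_eq hxpos (v := C *ᵥ y)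
    (u := fun i => quadForm C x y / dotp x y * y i) (fun i => ?_) ?_ i).symm
  · have h := hmin _ (single_mem_simplex i)
    rw [payoff_single C hy, payoff_eq_ofReal C hx hy,
      ENNReal.ofReal_le_ofReal_iff (div_nonneg (mulVec_nonneg hC hy i) (hy i).le)] at h
    exact (le_div_iff₀ (hy i)).1 h
  · rw [← quadForm_eq_sum_mulVec]
    exact (quadForm_eq_sum_mul_quotient C hx hy).symm

open Matrix in
/-- Against a multiplicative perturbation of a positive eigenvector, the payoffs of any two
strategies differ by a factor of at most `((1 + δ) / (1 - δ)) ^ 2`. -/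
theorem payoff_le_mul_payoff_of_near_eigenvector {n : ℕ} {C : Matrix (Fin n) (Fin n) ℝ}
    (hC : ∀ i j, 0 ≤ C i j) {y z : Fin n → ℝ} (hy : ∀ i, 0 < y i) {l : ℝ} (hl : 0 ≤ l)
    (heig : ∀ i, (C *ᵥ y) i = l * y i) {δ : ℝ} (hδ0 : 0 ≤ δ) (hδ1 : δ < 1)
    (hz : ∀ i, |z i - y i| ≤ δ * y i) {x w : Fin n → ℝ} (hx : x ∈ simplex n)
    (hw : w ∈ simplex n) :
    payoff C x z ≤ ENNReal.ofReal (1 + 4 * δ / (1 - δ) ^ 2) * payoff C w z := by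
  have hlo : ∀ i, (1 - δ) * y i ≤ z i := fun i => by linarith [(abs_le.1 (hz i)).1]
  have hup : ∀ i, z i ≤ (1 + δ) * y i := fun i => by linarith [(abs_le.1 (hz i)).2]
  have h1 : 0 < 1 - δ := by linarith
  have h2 : 0 < 1 + δ := by linarith
  have hzpos : ∀ i, 0 < z i := fun i => (mul_pos h1 (hy i)).trans_le (hlo i)
  have hCup : ∀ i, (C *ᵥ z) i ≤ (1 + δ) * (l * y i) := fun i => by
    rw [← heig i, Matrix.mulVec, dotProduct, Matrix.mulVec, dotProduct, Finset.mul_sum]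
    exact Finset.sum_le_sum fun j _ => by nlinarith [mul_le_mul_of_nonneg_left (hup j) (hC i j)]
  have hClo : ∀ i, (1 - δ) * (l * y i) ≤ (C *ᵥ z) i := fun i => by
    rw [← heig i, Matrix.mulVec, dotProduct, Matrix.mulVec, dotProduct, Finset.mul_sum]
    exact Finset.sum_le_sum fun j _ => by nlinarith [mul_le_mul_of_nonneg_left (hlo j) (hC i j)]
  have hqup : quadForm C x z / dotp x z ≤ (1 + δ) / (1 - δ) * l := by
    rw [div_le_iff₀ (dotp_pos hx hzpos), quadForm_eq_sum_mulVec, dotp, Finset.mul_sum]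
    refine Finset.sum_le_sum fun i _ => ?_
    have h : (C *ᵥ z) i ≤ (1 + δ) / (1 - δ) * l * z i := by
      calc (C *ᵥ z) i ≤ (1 + δ) * (l * y i) := hCup i
        _ = (1 + δ) / (1 - δ) * l * ((1 - δ) * y i) := by field_simp
        _ ≤ _ := mul_le_mul_of_nonneg_left (hlo i) (by positivity)
    nlinarith [mul_le_mul_of_nonneg_left h (hx.1 i)]
  have hqlo : (1 - δ) / (1 + δ) * l ≤ quadForm C w z / dotp w z := by
    rw [le_div_iff₀ (dotp_pos hw hzpos), quadForm_eq_sum_mulVec, dotp, Finset.mul_sum]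
    refine Finset.sum_le_sum fun i _ => ?_
    have h : (1 - δ) / (1 + δ) * l * z i ≤ (C *ᵥ z) i := by
      calc (1 - δ) / (1 + δ) * l * z i ≤ (1 - δ) / (1 + δ) * l * ((1 + δ) * y i) :=
            mul_le_mul_of_nonneg_left (hup i) (by positivity)
        _ = (1 - δ) * (l * y i) := by field_simp
        _ ≤ _ := hClo i
    nlinarith [mul_le_mul_of_nonneg_left h (hw.1 i)]
  have hfac : 0 ≤ 1 + 4 * δ / (1 - δ) ^ 2 := by positivity
  rw [payoff_eq_ofReal C hx hzpos, payoff_eq_ofReal C hw hzpos, ← ENNReal.ofReal_mul hfac]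
  refine ENNReal.ofReal_le_ofReal (hqup.trans ?_)
  calc (1 + δ) / (1 - δ) * l
      = (1 + 4 * δ / (1 - δ) ^ 2) * ((1 - δ) / (1 + δ) * l) := by
        field_simp
        ring
    _ ≤ _ := mul_le_mul_of_nonneg_left hqlo hfac

theorem stmt12 (n : ℕ) (hn : 1 ≤ n) (A B : Matrix (Fin n) (Fin n) ℝ)
    (hA : ∀ i j, 0 ≤ A i j) (hB : ∀ i j, 0 ≤ B i j)
    (xs ys : Fin n → ℝ) (hne : IsNash A B xs ys)
    (hxfull : ∀ i, 0 < xs i) (hyfull : ∀ i, 0 < ys i)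
    (δ : ℝ) (hδ0 : 0 ≤ δ) (hδ1 : δ < 1)
    (xh yh : Fin n → ℝ) (hxh : xh ∈ simplex n) (hyh : yh ∈ simplex n)
    (hxapp : ∀ i, |xh i - xs i| ≤ δ * xs i)
    (hyapp : ∀ i, |yh i - ys i| ≤ δ * ys i)
    (ε : ℝ) (hε : ε = 4 * δ / (1 - δ) ^ 2) :
    (∀ x ∈ simplex n, payoff A x yh ≤ ENNReal.ofReal (1 + ε) * payoff A xh yh) ∧
    (∀ y ∈ simplex n, payoff B xh yh / ENNReal.ofReal (1 + ε) ≤ payoff B xh y) := by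
  subst hε
  obtain ⟨hxs, hys, hmax, hmin⟩ := hne
  have hBt : ∀ i j, 0 ≤ B.transpose i j := fun i j => hB j i
  refine ⟨fun x hx => ?_, fun y hy => ENNReal.div_le_of_le_mul' ?_⟩
  · exact payoff_le_mul_payoff_of_near_eigenvector hA hyfull
      (quadForm_div_dotp_nonneg hA hxs hyfull)
      (mulVec_eq_of_payoff_max hA hxs hxfull hyfull hmax) hδ0 hδ1 hyapp hx hxh
  · rw [← payoff_transpose B xh yh, ← payoff_transpose B xh y]
    refine payoff_le_mul_payoff_of_near_eigenvector hBt hxfull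
      (quadForm_div_dotp_nonneg hBt hys hxfull)
      (mulVec_eq_of_payoff_min hBt hys hyfull hxfull fun z hz => ?_) hδ0 hδ1 hxapp hyh hy
    rw [payoff_transpose, payoff_transpose]
    exact hmin z hz
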